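/- Let Ω ⊂ ℝ^n be a bounded convex open set and let Λ ⊂ ℝ^n be a bounded open uniformly convex set with C^{1,1} boundary, and assume cl Ω ∩ cl Λ = ∅. Let P_Λ denote the metric projection onto cl Λ (so that P_Λ(Ω) ⊂ ∂Λ). Then the boundary, relative to ∂Λ, of the projection set satisfies H^{n−2}( ∂(P_Λ(Ω) ∩ ∂Λ) ) < ∞. -/

import Mathlib

open Metric Set MeasureTheory RealInnerProductSpace

/-- The point of `ℝ^{m+1}` with first `m` coordinates `x` and last coordinate `t`. -/
noncomputable def mkPt {m : ℕ} (x : EuclideanSpace ℝ (Fin m)) (t : ℝ) :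
    EuclideanSpace ℝ (Fin (m + 1)) :=
  (EuclideanSpace.equiv (Fin (m + 1)) ℝ).symm (Fin.snoc (EuclideanSpace.equiv (Fin m) ℝ x) t)

/-- The first `m` coordinates of a point of `ℝ^{m+1}`. -/
noncomputable def initPt {m : ℕ} (p : EuclideanSpace ℝ (Fin (m + 1))) :
    EuclideanSpace ℝ (Fin m) :=
  (EuclideanSpace.equiv (Fin m) ℝ).symm (Fin.init (EuclideanSpace.equiv (Fin (m + 1)) ℝ p))

/-- The last coordinate of a point of `ℝ^{m+1}`. -/
def lastCoord {m : ℕ} (p : EuclideanSpace ℝ (Fin (m + 1))) : ℝ := p (Fin.last m)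

/-- A bounded open convex set `Λ ⊂ ℝ^{m+1}` is *uniformly convex with `C^{1,1}` boundary* if
there are uniform constants `C₁, C₂ > 0` such that near each boundary point, after a rotation,
`∂Λ` is the graph of a concave function `φ` defined on an `m`-dimensional ball, with `Λ` lying
below the graph, where the gradient `G` of `φ` is Lipschitz with constant `C₂` and satisfies the
uniform concavity inequality `⟪G ỹ - G x̃, x̃ - ỹ⟫ ≥ C₁ ‖x̃ - ỹ‖²`. -/
def UniformlyConvexC11 {m : ℕ} (Λ : Set (EuclideanSpace ℝ (Fin (m + 1)))) : Prop :=
  ∃ C₁ C₂ : ℝ, 0 < C₁ ∧ 0 < C₂ ∧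
    ∀ w ∈ frontier Λ,
      ∃ (R : EuclideanSpace ℝ (Fin (m + 1)) ≃ₗᵢ[ℝ] EuclideanSpace ℝ (Fin (m + 1)))
        (r ρ : ℝ) (wt : EuclideanSpace ℝ (Fin m))
        (φ : EuclideanSpace ℝ (Fin m) → ℝ)
        (G : EuclideanSpace ℝ (Fin m) → EuclideanSpace ℝ (Fin m)),
        0 < r ∧ 0 < ρ ∧ R w = mkPt wt (φ wt) ∧
        (∀ z ∈ Metric.ball (R w) r, initPt z ∈ Metric.ball wt ρ) ∧
        (R '' Λ) ∩ Metric.ball (R w) r =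
          {z ∈ Metric.ball (R w) r | lastCoord z < φ (initPt z)} ∧
        (∀ x ∈ Metric.ball wt ρ, HasGradientAt φ (G x) x) ∧
        (∀ x ∈ Metric.ball wt ρ, ∀ y ∈ Metric.ball wt ρ, ‖G x - G y‖ ≤ C₂ * ‖x - y‖) ∧
        (∀ x ∈ Metric.ball wt ρ, ∀ y ∈ Metric.ball wt ρ,
          ⟪G y - G x, x - y⟫ ≥ C₁ * ‖x - y‖ ^ 2)

/-- The boundary of `S` relative to the topological space `∂Λ`, viewed as a subset of the
ambient space. -/
def relBd {F : Type*} [TopologicalSpace F] (Λ S : Set F) : Set F :=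
  (fun y : frontier Λ => (y : F)) '' frontier ((fun y : frontier Λ => (y : F)) ⁻¹' S)

section Coordinates

variable {m : ℕ}

theorem initPt_mkPt (x : EuclideanSpace ℝ (Fin m)) (t : ℝ) : initPt (mkPt x t) = x := by
  ext i
  simp [initPt, mkPt, Fin.init]

theorem lastCoord_mkPt (x : EuclideanSpace ℝ (Fin m)) (t : ℝ) : lastCoord (mkPt x t) = t := by
  simp [lastCoord, mkPt]

theorem mkPt_initPt_lastCoord (p : EuclideanSpace ℝ (Fin (m + 1))) :
    mkPt (initPt p) (lastCoord p) = p := by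
  ext i
  refine Fin.lastCases ?_ (fun j => ?_) i <;> simp [initPt, mkPt, lastCoord, Fin.init]

theorem inner_eq_inner_initPt_add (p q : EuclideanSpace ℝ (Fin (m + 1))) :
    ⟪p, q⟫ = ⟪initPt p, initPt q⟫ + lastCoord p * lastCoord q := by
  simp [PiLp.inner_apply, Fin.sum_univ_castSucc, initPt, lastCoord, Fin.init, mul_comm]

theorem initPt_sub (p q : EuclideanSpace ℝ (Fin (m + 1))) :
    initPt (p - q) = initPt p - initPt q := by
  ext i
  simp [initPt, Fin.init]

theorem lastCoord_sub (p q : EuclideanSpace ℝ (Fin (m + 1))) :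
    lastCoord (p - q) = lastCoord p - lastCoord q := by
  simp [lastCoord]

theorem norm_sq_eq_norm_sq_initPt_add (p : EuclideanSpace ℝ (Fin (m + 1))) :
    ‖p‖ ^ 2 = ‖initPt p‖ ^ 2 + lastCoord p ^ 2 := by
  rw [← real_inner_self_eq_norm_sq, inner_eq_inner_initPt_add, real_inner_self_eq_norm_sq,
    sq (lastCoord p)]

theorem norm_initPt_le (p : EuclideanSpace ℝ (Fin (m + 1))) : ‖initPt p‖ ≤ ‖p‖ := by
  have := norm_sq_eq_norm_sq_initPt_add p
  exact le_of_sq_le_sq (by nlinarith [sq_nonneg (lastCoord p)]) (norm_nonneg p)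

theorem continuous_mkPt :
    Continuous fun p : EuclideanSpace ℝ (Fin m) × ℝ => mkPt p.1 p.2 := by
  refine (EuclideanSpace.equiv (Fin (m + 1)) ℝ).symm.continuous.comp (continuous_pi fun i => ?_)
  refine Fin.lastCases ?_ (fun j => ?_) i
  · simpa using continuous_snd
  · simp only [Fin.snoc_castSucc]
    exact (continuous_apply j).comp
      ((EuclideanSpace.equiv (Fin m) ℝ).continuous.comp continuous_fst)

theorem continuous_initPt :
    Continuous (initPt : EuclideanSpace ℝ (Fin (m + 1)) → EuclideanSpace ℝ (Fin m)) := by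
  refine (EuclideanSpace.equiv (Fin m) ℝ).symm.continuous.comp (continuous_pi fun i => ?_)
  exact (continuous_apply i.castSucc).comp (EuclideanSpace.equiv (Fin (m + 1)) ℝ).continuous

theorem continuous_lastCoord :
    Continuous (lastCoord : EuclideanSpace ℝ (Fin (m + 1)) → ℝ) :=
  (continuous_apply (Fin.last m)).comp (EuclideanSpace.equiv (Fin (m + 1)) ℝ).continuous

end Coordinates

/-- `N` is a unit outward normal at `y` to the closed set `K`. -/
def IsUnitNormal {F : Type*} [NormedAddCommGroup F] [InnerProductSpace ℝ F]
    (K : Set F) (y N : F) : Prop :=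
  ‖N‖ = 1 ∧ ∀ q ∈ K, ⟪N, q - y⟫ ≤ 0

/-- Two unit vectors, written as nonnegative multiples of vectors of which the first has norm at least
one, are at most twice as far apart as the latter. -/
theorem norm_smul_sub_smul_le {F : Type*} [NormedAddCommGroup F] [NormedSpace ℝ F]
    {u₁ u₂ : F} {b₁ b₂ : ℝ} (hb₁ : 0 ≤ b₁) (hb₂ : 0 ≤ b₂) (hb₁' : b₁ ≤ 1)
    (h₁ : ‖b₁ • u₁‖ = 1) (h₂ : ‖b₂ • u₂‖ = 1) :
    ‖b₁ • u₁ - b₂ • u₂‖ ≤ 2 * ‖u₁ - u₂‖ := by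
  rw [norm_smul, Real.norm_of_nonneg hb₁] at h₁
  rw [norm_smul, Real.norm_of_nonneg hb₂] at h₂
  have hdec : b₁ • u₁ - b₂ • u₂ = b₁ • (u₁ - u₂) + (b₁ - b₂) • u₂ := by module
  have hsnd : ‖(b₁ - b₂) • u₂‖ ≤ b₁ * ‖u₁ - u₂‖ := by
    rw [norm_smul, Real.norm_eq_abs]
    calc |b₁ - b₂| * ‖u₂‖ = |(b₁ - b₂) * ‖u₂‖| := by rw [abs_mul, abs_norm]
      _ = |b₁ * (‖u₂‖ - ‖u₁‖)| := by congr 1; linear_combination h₁ - h₂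
      _ = b₁ * |‖u₂‖ - ‖u₁‖| := by rw [abs_mul, abs_of_nonneg hb₁]
      _ ≤ b₁ * ‖u₁ - u₂‖ := by
        rw [norm_sub_rev]
        exact mul_le_mul_of_nonneg_left (abs_norm_sub_norm_le _ _) hb₁
  calc ‖b₁ • u₁ - b₂ • u₂‖ ≤ ‖b₁ • (u₁ - u₂)‖ + ‖(b₁ - b₂) • u₂‖ := hdec ▸ norm_add_le _ _
    _ ≤ b₁ * ‖u₁ - u₂‖ + b₁ * ‖u₁ - u₂‖ := by
      rw [norm_smul, Real.norm_of_nonneg hb₁]; gcongr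
    _ ≤ 2 * ‖u₁ - u₂‖ := by nlinarith [norm_nonneg (u₁ - u₂)]

open Filter Topology in
/-- A normal to a subgraph at a point of the graph is a nonnegative multiple of `(-∇φ, 1)`. -/
theorem normal_subgraph {m : ℕ} {U : Set (EuclideanSpace ℝ (Fin (m + 1)))}
    {φ : EuclideanSpace ℝ (Fin m) → ℝ} {g x : EuclideanSpace ℝ (Fin m)}
    {ν : EuclideanSpace ℝ (Fin (m + 1))} (hU : U ∈ 𝓝 (mkPt x (φ x))) (hφ : HasGradientAt φ g x)
    (hν : ∀ z ∈ U, lastCoord z < φ (initPt z) → ⟪ν, z - mkPt x (φ x)⟫ ≤ 0) :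
    0 ≤ lastCoord ν ∧ initPt ν = -(lastCoord ν • g) := by
  set a := initPt ν
  set b := lastCoord ν
  have hcont : ContinuousAt (fun p : EuclideanSpace ℝ (Fin m) × ℝ => mkPt p.1 (φ p.1 - p.2))
      (x, 0) := by
    refine continuous_mkPt.continuousAt.comp (ContinuousAt.prodMk continuousAt_fst ?_)
    exact (ContinuousAt.comp (f := Prod.fst) (x := (x, (0 : ℝ))) hφ.continuousAt
      continuousAt_fst).sub continuousAt_snd
  have hev : ∀ᶠ p : EuclideanSpace ℝ (Fin m) × ℝ in 𝓝 (x, 0), mkPt p.1 (φ p.1 - p.2) ∈ U :=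
    hcont (by simpa using hU)
  have hineq : ∀ᶠ x' in 𝓝 x, ∀ᶠ ε in 𝓝[>] (0 : ℝ),
      ⟪a, x' - x⟫ + b * (φ x' - ε - φ x) ≤ 0 := by
    filter_upwards [hev.curry_nhds] with x' hx'
    filter_upwards [hx'.filter_mono nhdsWithin_le_nhds, self_mem_nhdsWithin] with ε hε hpos
    have := hν _ hε (by simpa [initPt_mkPt, lastCoord_mkPt] using hpos)
    simpa [inner_eq_inner_initPt_add, initPt_sub, lastCoord_sub, initPt_mkPt, lastCoord_mkPt]
      using this
  have hb : 0 ≤ b := by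
    obtain ⟨ε, hε, hpos⟩ := (hineq.self_of_nhds.and self_mem_nhdsWithin).exists
    simp only [sub_self, inner_zero_right, zero_add] at hε
    have hpos' : (0 : ℝ) < ε := hpos
    by_contra! hneg
    nlinarith
  refine ⟨hb, ?_⟩
  have hmax : IsLocalMax (fun x' => ⟪a, x'⟫ + b * φ x') x := by
    filter_upwards [hineq] with x' hx'
    have hlim : Tendsto (fun ε => ⟪a, x' - x⟫ + b * (φ x' - ε - φ x)) (𝓝[>] (0 : ℝ))
        (𝓝 (⟪a, x' - x⟫ + b * (φ x' - 0 - φ x))) := by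
      refine Tendsto.mono_left (Continuous.tendsto ?_ 0) nhdsWithin_le_nhds
      fun_prop
    have := le_of_tendsto hlim hx'
    rw [inner_sub_right] at this
    linarith
  have hder : HasFDerivAt (fun x' => ⟪a, x'⟫ + b * φ x')
      (innerSL ℝ a + b • InnerProductSpace.toDual ℝ _ g) x :=
    (innerSL ℝ a).hasFDerivAt.add (hφ.hasFDerivAt.const_mul b)
  have hzero := hmax.hasFDerivAt_eq_zero hder
  refine ext_inner_right ℝ fun v => ?_
  have := DFunLike.congr_fun hzero v
  simp at this
  simp [inner_neg_left, real_inner_smul_left]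
  linarith

/-- The unit normal of a convex set with `C^{1,1}` boundary is locally Lipschitz. -/
theorem UniformlyConvexC11.exists_lipschitz_normal {m : ℕ}
    {Λ : Set (EuclideanSpace ℝ (Fin (m + 1)))} (hΛo : IsOpen Λ) (h : UniformlyConvexC11 Λ) :
    ∃ L : ℝ, 0 ≤ L ∧ ∀ w ∈ frontier Λ, ∃ r > 0,
      ∀ y₁ ∈ frontier Λ ∩ ball w r, ∀ y₂ ∈ frontier Λ ∩ ball w r, ∀ N₁ N₂,
        IsUnitNormal (closure Λ) y₁ N₁ → IsUnitNormal (closure Λ) y₂ N₂ →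
          ‖N₁ - N₂‖ ≤ L * ‖y₁ - y₂‖ := by
  obtain ⟨C₁, C₂, -, hC₂, h⟩ := h
  refine ⟨2 * C₂, by positivity, fun w hw => ?_⟩
  obtain ⟨R, r, ρ, wt, φ, G, hr, -, -, hinit, hgraph, hgrad, hlip, -⟩ := h w hw
  refine ⟨r, hr, ?_⟩
  have hball : ∀ y ∈ ball w r, R y ∈ ball (R w) r := fun y hy => by
    simpa [mem_ball, R.dist_map] using hy
  have hlast : ∀ y ∈ frontier Λ ∩ ball w r, lastCoord (R y) = φ (initPt (R y)) := by
    rintro y ⟨hy, hyr⟩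
    apply le_antisymm
    · by_contra! hlt
      have hcφ : ContinuousAt φ (initPt (R y)) := (hgrad _ (hinit _ (hball y hyr))).continuousAt
      have hc : ContinuousAt (fun z => φ (initPt (R z))) y :=
        ContinuousAt.comp (f := fun z => initPt (R z)) hcφ
          (continuous_initPt.comp R.continuous).continuousAt
      have hl : ContinuousAt (fun z => lastCoord (R z)) y :=
        (continuous_lastCoord.comp R.continuous).continuousAt
      have hev := (hc.eventually_lt hl hlt).and (isOpen_ball.mem_nhds hyr)
      obtain ⟨z, ⟨hz, hzr⟩, hzΛ⟩ := mem_closure_iff_nhds.1 (frontier_subset_closure hy) _ hev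
      have : R z ∈ (R '' Λ) ∩ ball (R w) r := ⟨⟨z, hzΛ, rfl⟩, hball z hzr⟩
      rw [hgraph] at this
      exact lt_asymm hz this.2
    · by_contra! hlt
      have : R y ∈ (R '' Λ) ∩ ball (R w) r := by
        rw [hgraph]
        exact ⟨hball y hyr, hlt⟩
      obtain ⟨z, hz, hzy⟩ := this.1
      rw [R.injective hzy] at hz
      rw [hΛo.frontier_eq] at hy
      exact hy.2 hz
  have hnormal : ∀ y ∈ frontier Λ ∩ ball w r, ∀ N, IsUnitNormal (closure Λ) y N →
      0 ≤ lastCoord (R N) ∧ lastCoord (R N) ≤ 1 ∧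
        R N = lastCoord (R N) • mkPt (-G (initPt (R y))) 1 := by
    rintro y hy N ⟨hN, hNy⟩
    have hy' : mkPt (initPt (R y)) (φ (initPt (R y))) = R y := by
      rw [← hlast y hy, mkPt_initPt_lastCoord]
    obtain ⟨hb, ha⟩ := normal_subgraph (U := ball (R w) r) (ν := R N)
      (by rw [hy']; exact isOpen_ball.mem_nhds (hball y hy.2))
      (hgrad _ (hinit _ (hball y hy.2))) (by
        intro z hz hlt
        rw [hy']
        have : z ∈ (R '' Λ) ∩ ball (R w) r := by rw [hgraph]; exact ⟨hz, hlt⟩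
        obtain ⟨⟨q, hq, rfl⟩, -⟩ := this
        rw [← map_sub, R.inner_map_map]
        exact hNy q (subset_closure hq))
    refine ⟨hb, ?_, ?_⟩
    · have := norm_sq_eq_norm_sq_initPt_add (R N)
      rw [R.norm_map, hN] at this
      nlinarith [sq_nonneg ‖initPt (R N)‖]
    · conv_lhs => rw [← mkPt_initPt_lastCoord (R N), ha]
      ext i
      refine Fin.lastCases ?_ (fun j => ?_) i <;> simp [mkPt]
  intro y₁ hy₁ y₂ hy₂ N₁ N₂ hN₁ hN₂
  obtain ⟨h₁, h₁', e₁⟩ := hnormal y₁ hy₁ N₁ hN₁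
  obtain ⟨h₂, -, e₂⟩ := hnormal y₂ hy₂ N₂ hN₂
  have hu : ‖mkPt (-G (initPt (R y₁))) 1 - mkPt (-G (initPt (R y₂))) 1‖ ≤ C₂ * ‖y₁ - y₂‖ := by
    refine le_trans (le_of_sq_le_sq (b := ‖G (initPt (R y₁)) - G (initPt (R y₂))‖) ?_
      (norm_nonneg _)) ((hlip _ (hinit _ (hball _ hy₁.2)) _ (hinit _ (hball _ hy₂.2))).trans ?_)
    · rw [norm_sq_eq_norm_sq_initPt_add, initPt_sub, lastCoord_sub]
      simp only [initPt_mkPt, lastCoord_mkPt, sub_self]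
      rw [neg_sub_neg, norm_sub_rev]
      simp
    · rw [← initPt_sub, ← map_sub]
      gcongr
      exact (norm_initPt_le _).trans_eq (R.norm_map _)
  calc ‖N₁ - N₂‖ = ‖R N₁ - R N₂‖ := by rw [← map_sub, R.norm_map]
    _ ≤ 2 * ‖mkPt (-G (initPt (R y₁))) 1 - mkPt (-G (initPt (R y₂))) 1‖ := by
      rw [e₁, e₂]
      exact norm_smul_sub_smul_le h₁ h₂ h₁' (by rw [← e₁, R.norm_map, hN₁.1])
        (by rw [← e₂, R.norm_map, hN₂.1])
    _ ≤ 2 * C₂ * ‖y₁ - y₂‖ := by linarith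

section MetricProjection

variable {F : Type*} [NormedAddCommGroup F] [InnerProductSpace ℝ F]

theorem inner_sub_proj_le_zero {K : Set F} (hK : Convex ℝ K) {x p : F} (hp : p ∈ K)
    (hmin : ∀ q ∈ K, dist x p ≤ dist x q) {q : F} (hq : q ∈ K) : ⟪x - p, q - p⟫ ≤ 0 := by
  have : Nonempty K := ⟨⟨p, hp⟩⟩
  refine (norm_eq_iInf_iff_real_inner_le_zero hK hp).1 (le_antisymm ?_ ?_) q hq
  · exact le_ciInf fun w => by simpa [dist_eq_norm] using hmin w w.2
  · exact ciInf_le (f := fun w : K => ‖x - w‖) ⟨0, by rintro _ ⟨w, rfl⟩; positivity⟩ ⟨p, hp⟩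

theorem norm_proj_sub_proj_le {K : Set F} {x₁ x₂ p₁ p₂ : F} (h₁ : p₁ ∈ K) (h₂ : p₂ ∈ K)
    (hx₁ : ∀ q ∈ K, ⟪x₁ - p₁, q - p₁⟫ ≤ 0) (hx₂ : ∀ q ∈ K, ⟪x₂ - p₂, q - p₂⟫ ≤ 0) :
    ‖p₁ - p₂‖ ≤ ‖x₁ - x₂‖ := by
  have e₁ := hx₁ p₂ h₂
  have e₂ := hx₂ p₁ h₁
  have key : ‖p₁ - p₂‖ ^ 2 ≤ ⟪x₁ - x₂, p₁ - p₂⟫ := by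
    rw [← real_inner_self_eq_norm_sq]
    simp only [inner_sub_left, inner_sub_right] at *
    linarith
  have := real_inner_le_norm (x₁ - x₂) (p₁ - p₂)
  by_contra! hlt
  nlinarith [norm_nonneg (x₁ - x₂)]

theorem IsUnitNormal.proj_add_smul {K : Set F} {y N p : F} {t : ℝ} (hN : IsUnitNormal K y N)
    (ht : 0 ≤ t) (hy : y ∈ K) (hp : p ∈ K) (hproj : ∀ q ∈ K, ⟪y + t • N - p, q - p⟫ ≤ 0) :
    p = y := by
  have h₁ := hproj y hy
  have h₂ := hN.2 p hp
  have e : y + t • N - p = (y - p) + t • N := by abel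
  rw [e, inner_add_left, real_inner_smul_left, real_inner_self_eq_norm_sq] at h₁
  rw [← neg_sub, inner_neg_right] at h₂
  have : ‖y - p‖ ^ 2 ≤ 0 := by nlinarith
  have : ‖y - p‖ = 0 := by nlinarith [norm_nonneg (y - p)]
  exact (sub_eq_zero.1 (norm_eq_zero.1 this)).symm

theorem isUnitNormal_proj {K : Set F} {x p : F} (hne : x ≠ p)
    (hproj : ∀ q ∈ K, ⟪x - p, q - p⟫ ≤ 0) : IsUnitNormal K p (‖x - p‖⁻¹ • (x - p)) := by
  refine ⟨norm_smul_inv_norm (𝕜 := ℝ) (sub_ne_zero.2 hne), fun q hq => ?_⟩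
  rw [real_inner_smul_left]
  exact mul_nonpos_of_nonneg_of_nonpos (by positivity) (hproj q hq)

theorem IsUnitNormal.mem_frontier {Λ : Set F} {y N : F} (hΛ : IsOpen Λ)
    (hN : IsUnitNormal (closure Λ) y N) (hy : y ∈ closure Λ) : y ∈ frontier Λ := by
  rw [hΛ.frontier_eq]
  refine ⟨hy, fun hyΛ => ?_⟩
  obtain ⟨ε, hε, hball⟩ := Metric.isOpen_iff.1 hΛ y hyΛ
  have hmem : y + (ε / 2) • N ∈ Λ := hball (by
    rw [mem_ball, dist_eq_norm, add_sub_cancel_left, norm_smul, hN.1, mul_one,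
      Real.norm_of_nonneg (by positivity)]
    linarith)
  have := hN.2 _ (subset_closure hmem)
  rw [add_sub_cancel_left, real_inner_smul_right, real_inner_self_eq_norm_sq, hN.1] at this
  linarith

variable [CompleteSpace F]

/-- A nonzero continuous functional is a positive multiple of the inner product with a unit
vector. -/
theorem exists_unit_vector_of_dual (f : StrongDual ℝ F) (hf : f ≠ 0) :
    ∃ (v : F) (c : ℝ), ‖v‖ = 1 ∧ 0 < c ∧ ∀ x, f x = c * ⟪v, x⟫ := by
  set u := (InnerProductSpace.toDual ℝ F).symm f with hu
  have hu0 : u ≠ 0 := by simpa [hu] using hf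
  refine ⟨‖u‖⁻¹ • u, ‖u‖, norm_smul_inv_norm (𝕜 := ℝ) hu0, norm_pos_iff.2 hu0, fun x => ?_⟩
  rw [real_inner_smul_left, mul_inv_cancel_left₀ (norm_ne_zero_iff.2 hu0), hu,
    InnerProductSpace.toDual_symm_apply]

theorem exists_isUnitNormal {Λ : Set F} (hΛo : IsOpen Λ) (hΛ : Convex ℝ Λ) {y : F}
    (hy : y ∈ frontier Λ) : ∃ N, IsUnitNormal (closure Λ) y N := by
  rw [hΛo.frontier_eq] at hy
  obtain ⟨f, hf⟩ := geometric_hahn_banach_open_point hΛ hΛo hy.2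
  have hne : Λ.Nonempty := closure_nonempty_iff.1 ⟨y, hy.1⟩
  have hf0 : f ≠ 0 := by
    rintro rfl
    simpa using hf _ hne.some_mem
  obtain ⟨v, c, hv, hc, hfv⟩ := exists_unit_vector_of_dual f hf0
  refine ⟨v, hv, fun q hq => ?_⟩
  have hle : f q ≤ f y := closure_minimal (t := {q | f q ≤ f y}) (fun a ha => (hf a ha).le)
    (isClosed_le f.continuous continuous_const) hq
  rw [hfv, hfv] at hle
  rw [inner_sub_right]
  linarith [le_of_mul_le_mul_left hle hc]

/-- If an open ray misses an open convex set but meets its closure, then there is a hyperplane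
containing the ray and supporting the convex set. -/
theorem exists_supporting_of_ray {Ω : Set F} (hΩo : IsOpen Ω) (hΩ : Convex ℝ Ω) {y N : F}
    (hray : ∀ t : ℝ, 0 < t → y + t • N ∉ Ω) {s : ℝ} (hs : 0 < s) (hx : y + s • N ∈ closure Ω) :
    ∃ v : F, ‖v‖ = 1 ∧ ⟪v, N⟫ = 0 ∧ ∀ z ∈ closure Ω, 0 ≤ ⟪v, z - (y + s • N)⟫ := by
  have hconv : Convex ℝ ((fun t : ℝ => y + t • N) '' Ioi 0) := by
    have := ((convex_Ioi (0 : ℝ)).linear_image (LinearMap.toSpanSingleton ℝ F N)).translate y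
    rwa [image_image] at this
  obtain ⟨f, u, hfΩ, hfray⟩ := geometric_hahn_banach_open hΩ hΩo hconv (by
    rw [Set.disjoint_left]
    rintro _ hz ⟨t, ht, rfl⟩
    exact hray t ht hz)
  have hfcl : ∀ z ∈ closure Ω, f z ≤ u := fun z hz =>
    closure_minimal (t := {q | f q ≤ u}) (fun a ha => (hfΩ a ha).le)
    (isClosed_le f.continuous continuous_const) hz
  have hfge : ∀ t : ℝ, 0 < t → u ≤ f y + t * f N := fun t ht => by
    simpa using hfray _ ⟨t, ht, rfl⟩
  have hfx : f y + s * f N ≤ u := by simpa using hfcl _ hx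
  have hfN : f N = 0 := by
    have h₁ := hfge (s / 2) (by positivity)
    have h₂ := hfge (2 * s) (by positivity)
    refine le_antisymm ?_ ?_ <;> by_contra! <;> nlinarith
  have hfy : f y = u := by
    have := hfge s hs
    rw [hfN] at this hfx
    linarith
  have hne : Ω.Nonempty := closure_nonempty_iff.1 ⟨_, hx⟩
  have hf0 : f ≠ 0 := by
    rintro rfl
    have := hfΩ _ hne.some_mem
    simp at this hfy
    linarith
  obtain ⟨v, c, hv, hc, hfv⟩ := exists_unit_vector_of_dual f hf0
  refine ⟨-v, by rwa [norm_neg], ?_, fun z hz => ?_⟩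
  · rw [hfv] at hfN
    simpa [inner_neg_left, hc.ne'] using hfN
  · have hle : f (z - (y + s • N)) ≤ 0 := by
      rw [map_sub, map_add, map_smul, hfN, hfy]
      simpa using hfcl z hz
    rw [hfv] at hle
    rw [inner_neg_left]
    by_contra! hlt
    nlinarith

end MetricProjection

/-- The points of `closure Ω` at which the line joining `x` to `P x` lies in a supporting hyperplane
of `Ω`. -/
def touchingSet {F : Type*} [NormedAddCommGroup F] [InnerProductSpace ℝ F] (Ω : Set F)
    (P : F → F) : Set F :=
  {x | x ∈ closure Ω ∧ ∃ v : F, ‖v‖ = 1 ∧ ⟪v, x - P x⟫ = 0 ∧ ∀ z ∈ closure Ω, 0 ≤ ⟪v, z - x⟫}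

open Filter Topology in
theorem relBd_subset_image_touchingSet {m : ℕ} {Ω Λ : Set (EuclideanSpace ℝ (Fin (m + 1)))}
    (hΩo : IsOpen Ω) (hΩb : Bornology.IsBounded Ω) (hΩconv : Convex ℝ Ω)
    (hΛo : IsOpen Λ) (hΛconv : Convex ℝ Λ) {L : ℝ}
    (hlip : ∀ w ∈ frontier Λ, ∃ r > 0,
      ∀ y₁ ∈ frontier Λ ∩ ball w r, ∀ y₂ ∈ frontier Λ ∩ ball w r, ∀ N₁ N₂,
        IsUnitNormal (closure Λ) y₁ N₁ → IsUnitNormal (closure Λ) y₂ N₂ →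
          ‖N₁ - N₂‖ ≤ L * ‖y₁ - y₂‖)
    (hdisj : closure Ω ∩ closure Λ = ∅)
    {P : EuclideanSpace ℝ (Fin (m + 1)) → EuclideanSpace ℝ (Fin (m + 1))}
    (hPmem : ∀ x, P x ∈ closure Λ)
    (hproj : ∀ x, ∀ q ∈ closure Λ, ⟪x - P x, q - P x⟫ ≤ 0) :
    relBd Λ (P '' Ω ∩ frontier Λ) ⊆ P '' touchingSet Ω P := by
  have hPcont : Continuous P := by
    refine (LipschitzWith.of_dist_le' (K := 1) fun x₁ x₂ => ?_).continuous
    simpa [dist_eq_norm] using norm_proj_sub_proj_le (hPmem x₁) (hPmem x₂) (hproj x₁) (hproj x₂)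
  rintro _ ⟨y, hy, rfl⟩
  have hycl : (y : EuclideanSpace ℝ (Fin (m + 1))) ∈ P '' closure Ω := by
    have h₁ : (y : EuclideanSpace ℝ (Fin (m + 1))) ∈ closure (P '' Ω ∩ frontier Λ) :=
      closure_mono (image_preimage_subset _ _)
        (image_closure_subset_closure_image continuous_subtype_val
          ⟨y, frontier_subset_closure hy, rfl⟩)
    exact closure_minimal (inter_subset_left.trans (image_mono subset_closure))
      (hΩb.isCompact_closure.image hPcont).isClosed h₁
  obtain ⟨x, hx, hxy⟩ := hycl
  have hxP : x ≠ P x := fun h => by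
    have : x ∈ closure Ω ∩ closure Λ := ⟨hx, h ▸ hPmem x⟩
    simp [hdisj] at this
  set s := ‖x - P x‖ with hs
  have hs0 : 0 < s := norm_pos_iff.2 (sub_ne_zero.2 hxP)
  set N := s⁻¹ • (x - P x) with hN
  have hNn : IsUnitNormal (closure Λ) (P x) N := isUnitNormal_proj hxP (hproj x)
  have hxN : P x + s • N = x := by
    rw [hN, smul_inv_smul₀ hs0.ne']; abel
  have hray : ∀ t : ℝ, 0 < t → P x + t • N ∉ Ω := by
    intro t ht hmem
    apply hy.2
    rw [mem_interior_iff_mem_nhds]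
    choose ν hν using fun z : frontier Λ => exists_isUnitNormal hΛo hΛconv z.2
    obtain ⟨r, hr, hL⟩ := hlip y y.2
    have hνlim : Tendsto (fun z : frontier Λ => (z : EuclideanSpace ℝ (Fin (m + 1))) + t • ν z)
        (𝓝 y) (𝓝 (P x + t • N)) := by
      rw [hxy]
      refine continuous_subtype_val.continuousAt.tendsto.add (Tendsto.const_smul ?_ t)
      rw [tendsto_iff_norm_sub_tendsto_zero]
      have hbd : Tendsto (fun z : frontier Λ =>
          L * ‖(z : EuclideanSpace ℝ (Fin (m + 1))) - y‖) (𝓝 y) (𝓝 0) := by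
        have : Continuous (fun z : frontier Λ =>
          L * ‖(z : EuclideanSpace ℝ (Fin (m + 1))) - y‖) := by fun_prop
        simpa using this.tendsto y
      refine squeeze_zero' (Eventually.of_forall fun _ => norm_nonneg _) ?_ hbd
      filter_upwards [continuous_subtype_val.continuousAt.preimage_mem_nhds
        (isOpen_ball.mem_nhds (mem_ball_self hr))] with z hz
      exact hL z ⟨z.2, hz⟩ y ⟨y.2, mem_ball_self hr⟩ _ _ (hν z) (hxy ▸ hNn)
    filter_upwards [hνlim (hΩo.mem_nhds hmem)] with z hz
    refine ⟨⟨_, hz, ?_⟩, z.2⟩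
    exact (hν z).proj_add_smul ht.le (frontier_subset_closure z.2) (hPmem _) (hproj _)
  obtain ⟨v, hv, hvN, hvΩ⟩ := exists_supporting_of_ray hΩo hΩconv hray hs0 (by rwa [hxN])
  refine ⟨x, ⟨hx, v, hv, ?_, by rwa [hxN] at hvΩ⟩, hxy⟩
  rw [hN, real_inner_smul_right] at hvN
  simpa [hs0.ne'] using hvN

/-- A set that is a Lipschitz image of a bounded subset of a `d`-dimensional space has finite
`d`-dimensional Hausdorff measure. -/
theorem hausdorffMeasure_image_lt_top {X F W : Type*} [Nonempty X]
    [NormedAddCommGroup F] [MeasurableSpace F] [BorelSpace F]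
    [NormedAddCommGroup W] [NormedSpace ℝ W] [FiniteDimensional ℝ W]
    {S : Set X} {P : X → F} {q : X → W} {C : ℝ}
    (hq : Bornology.IsBounded (q '' S))
    (h : ∀ x₁ ∈ S, ∀ x₂ ∈ S, ‖P x₁ - P x₂‖ ≤ C * ‖q x₁ - q x₂‖) :
    μH[Module.finrank ℝ W] (P '' S) < ⊤ := by
  borelize W
  have hinv : ∀ w ∈ q '' S, Function.invFunOn q S w ∈ S ∧ q (Function.invFunOn q S w) = w :=
    fun w hw => ⟨Function.invFunOn_mem hw, Function.invFunOn_eq hw⟩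
  have hlip : LipschitzOnWith C.toNNReal (P ∘ Function.invFunOn q S) (q '' S) := by
    refine LipschitzOnWith.of_dist_le' fun w₁ h₁ w₂ h₂ => ?_
    have := h _ (hinv w₁ h₁).1 _ (hinv w₂ h₂).1
    rwa [(hinv w₁ h₁).2, (hinv w₂ h₂).2, ← dist_eq_norm, ← dist_eq_norm] at this
  have himage : P '' S ⊆ (P ∘ Function.invFunOn q S) '' (q '' S) := by
    rintro _ ⟨x, hx, rfl⟩
    have hqx := hinv _ (mem_image_of_mem q hx)
    refine ⟨q x, mem_image_of_mem q hx, ?_⟩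
    have := h _ hqx.1 _ hx
    rw [hqx.2, sub_self, norm_zero, mul_zero] at this
    exact sub_eq_zero.1 (norm_le_zero_iff.1 this)
  calc μH[Module.finrank ℝ W] (P '' S)
      ≤ μH[Module.finrank ℝ W] ((P ∘ Function.invFunOn q S) '' (q '' S)) := measure_mono himage
    _ ≤ (C.toNNReal : ENNReal) ^ (Module.finrank ℝ W : ℝ) * μH[Module.finrank ℝ W] (q '' S) :=
      hlip.hausdorffMeasure_image_le (by positivity)
    _ < ⊤ := ENNReal.mul_lt_top (by simp) hq.measure_lt_top

/-- If `Δ = α N + l w + e`, where the component along the unit vector `N` is small and `Δ` lies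
outside a cone around `w` and outside the opposite cone, then `Δ` is controlled by `e`. -/
theorem norm_le_of_notMem_cones {F : Type*} [NormedAddCommGroup F] [InnerProductSpace ℝ F]
    {Δ N w e v₁ v₂ : F} {α l c ε : ℝ} (hc : 0 < c) (hε : ε * (2 * ‖w‖ + c) ≤ c / 2)
    (hN : ‖N‖ = 1) (hv₁ : ‖v₁‖ = 1) (hv₂ : ‖v₂‖ = 1) (hΔ : α • N + l • w + e = Δ)
    (hα : |α| ≤ ε * ‖Δ‖ / 2) (hw₁ : c ≤ ⟪v₁, w⟫) (hw₂ : c ≤ ⟪v₂, w⟫)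
    (h₁ : -(ε * ‖Δ‖ / 2) ≤ ⟪v₁, Δ⟫) (h₂ : -(ε * ‖Δ‖ / 2) ≤ -⟪v₂, Δ⟫) :
    ‖Δ‖ ≤ 2 * (‖w‖ + c) / c * ‖e‖ := by
  have hexp : ∀ v : F, ⟪v, Δ⟫ = α * ⟪v, N⟫ + l * ⟪v, w⟫ + ⟪v, e⟫ := fun v => by
    rw [← hΔ, inner_add_right, inner_add_right, real_inner_smul_right, real_inner_smul_right]
  have hαN : ∀ v : F, ‖v‖ = 1 → |α * ⟪v, N⟫| ≤ ε * ‖Δ‖ / 2 := fun v hv => by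
    have := abs_real_inner_le_norm v N
    rw [hv, hN, mul_one] at this
    rw [abs_mul]
    nlinarith [abs_nonneg α]
  have he : ∀ v : F, ‖v‖ = 1 → |⟪v, e⟫| ≤ ‖e‖ := fun v hv => by
    simpa [hv] using abs_real_inner_le_norm v e
  have hl : |l| * c ≤ ‖e‖ + ε * ‖Δ‖ := by
    rcases le_total 0 l with hl | hl
    · rw [abs_of_nonneg hl]
      have := hexp v₂
      nlinarith [abs_le.1 (hαN v₂ hv₂), abs_le.1 (he v₂ hv₂), mul_le_mul_of_nonneg_left hw₂ hl]
    · rw [abs_of_nonpos hl]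
      have := hexp v₁
      nlinarith [abs_le.1 (hαN v₁ hv₁), abs_le.1 (he v₁ hv₁),
        mul_le_mul_of_nonpos_left hw₁ hl]
  have hnorm : ‖Δ‖ ≤ ε * ‖Δ‖ / 2 + |l| * ‖w‖ + ‖e‖ := by
    calc ‖Δ‖ = ‖α • N + l • w + e‖ := by rw [hΔ]
      _ ≤ ‖α • N‖ + ‖l • w‖ + ‖e‖ := norm_add₃_le
      _ ≤ _ := by
        rw [norm_smul, norm_smul, hN, mul_one, Real.norm_eq_abs, Real.norm_eq_abs]
        gcongr
  have hεΔ : 0 ≤ ε * ‖Δ‖ := by linarith [abs_nonneg α]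
  have hmain : c * ‖Δ‖ ≤ 2 * (‖w‖ + c) * ‖e‖ := by
    have e₁ := mul_le_mul_of_nonneg_left hnorm hc.le
    have e₂ := mul_le_mul_of_nonneg_right hl (norm_nonneg w)
    have e₃ := mul_le_mul_of_nonneg_right hε (norm_nonneg Δ)
    nlinarith [norm_nonneg w, norm_nonneg e, mul_nonneg hεΔ (norm_nonneg w)]
  rw [div_mul_eq_mul_div, le_div_iff₀ hc]
  linarith

theorem finrank_orthogonal_span_pair {F : Type*} [NormedAddCommGroup F] [InnerProductSpace ℝ F]
    [FiniteDimensional ℝ F] {N w : F} (hN : N ≠ 0) (hw : w ≠ 0) (hNw : ⟪N, w⟫ = 0) :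
    Module.finrank ℝ (Submodule.span ℝ {N, w})ᗮ + 2 = Module.finrank ℝ F := by
  have hli : LinearIndependent ℝ ![N, w] := by
    refine linearIndependent_of_ne_zero_of_inner_eq_zero (𝕜 := ℝ) ?_ ?_
    · intro i
      fin_cases i <;> simpa
    · intro i j hij
      fin_cases i <;> fin_cases j <;> simp_all [real_inner_comm]
  have h₂ := finrank_span_eq_card hli
  rw [Matrix.range_cons_cons_empty, Fintype.card_fin] at h₂
  have := (Submodule.span ℝ {N, w}).finrank_add_finrank_orthogonal
  omega

/-- Displacement estimates for two points `x₁ = y₁ + s₁ N₁`, `x₂ = y₂ + s₂ N₂` transported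
along the normals to the common height `s`. -/
theorem parallel_displacement {F : Type*} [NormedAddCommGroup F] [InnerProductSpace ℝ F]
    {K : Set F} {y₁ y₂ N₁ N₂ : F} {s : ℝ} (hs : 0 ≤ s) (hy₁ : y₁ ∈ K) (hy₂ : y₂ ∈ K)
    (h₁ : IsUnitNormal K y₁ N₁) (h₂ : IsUnitNormal K y₂ N₂) :
    ‖y₁ - y₂‖ ≤ ‖(y₁ + s • N₁) - (y₂ + s • N₂)‖ ∧
      |⟪N₁, (y₁ + s • N₁) - (y₂ + s • N₂)⟫| ≤
        ‖N₁ - N₂‖ * ‖(y₁ + s • N₁) - (y₂ + s • N₂)‖ := by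
  set Δ := (y₁ + s • N₁) - (y₂ + s • N₂) with hΔ
  have e₁ := h₁.2 y₂ hy₂
  have e₂ := h₂.2 y₁ hy₁
  have hdec : Δ = (y₁ - y₂) + s • (N₁ - N₂) := by rw [hΔ]; module
  have hN := real_inner_le_norm N₁ N₂
  rw [h₁.1, h₂.1, mul_one] at hN
  have f₁ : 0 ≤ ⟪N₁, Δ⟫ := by
    rw [hdec, inner_add_right, real_inner_smul_right, inner_sub_right N₁ N₁,
      real_inner_self_eq_norm_sq, h₁.1, ← neg_sub y₂, inner_neg_right]
    nlinarith
  have f₂ : ⟪N₂, Δ⟫ ≤ 0 := by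
    rw [hdec, inner_add_right, real_inner_smul_right, inner_sub_right N₂ N₁,
      real_inner_self_eq_norm_sq, h₂.1, real_inner_comm N₁ N₂]
    nlinarith
  constructor
  · refine le_of_sq_le_sq ?_ (norm_nonneg _)
    rw [hdec, norm_add_sq_real, real_inner_smul_right]
    have : 0 ≤ ⟪y₁ - y₂, N₁ - N₂⟫ := by
      rw [← neg_sub y₁, inner_neg_right] at e₁
      rw [inner_sub_right, real_inner_comm, real_inner_comm N₂]
      linarith
    nlinarith [mul_nonneg hs this, sq_nonneg ‖s • (N₁ - N₂)‖]
  · rw [abs_of_nonneg f₁]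
    have := real_inner_le_norm (N₁ - N₂) Δ
    rw [inner_sub_left] at this
    linarith

/-- A threshold below which two linear constraints hold. -/
theorem exists_pos_small {r a b a' b' : ℝ} (hr : 0 < r) (ha : 0 ≤ a) (hb : 0 < b) (ha' : 0 ≤ a')
    (hb' : 0 < b') : ∃ δ > 0, δ ≤ r ∧ δ * a ≤ b ∧ δ * a' ≤ b' := by
  refine ⟨min r (min (b / (a + 1)) (b' / (a' + 1))), by positivity, min_le_left _ _, ?_, ?_⟩
  · calc _ ≤ b / (a + 1) * (a + 1) := by
          gcongr
          · exact (min_le_right _ _).trans (min_le_left _ _)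
          · linarith
      _ = b := by field_simp
  · calc _ ≤ b' / (a' + 1) * (a' + 1) := by
          gcongr
          · exact (min_le_right _ _).trans (min_le_right _ _)
          · linarith
      _ = b' := by field_simp

/-- The projection of a small piece of the touching set has finite codimension-two Hausdorff
measure. -/
theorem exists_hausdorffMeasure_proj_touchingSet_lt_top {F : Type*} [NormedAddCommGroup F]
    [InnerProductSpace ℝ F] [FiniteDimensional ℝ F] [MeasurableSpace F] [BorelSpace F]
    {Ω Λ : Set F} {d : ℕ} (hd : Module.finrank ℝ F = d + 2) (hΛo : IsOpen Λ) {L : ℝ} (hL : 0 ≤ L)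
    (hlip : ∀ w ∈ frontier Λ, ∃ r > 0,
      ∀ y₁ ∈ frontier Λ ∩ ball w r, ∀ y₂ ∈ frontier Λ ∩ ball w r, ∀ N₁ N₂,
        IsUnitNormal (closure Λ) y₁ N₁ → IsUnitNormal (closure Λ) y₂ N₂ →
          ‖N₁ - N₂‖ ≤ L * ‖y₁ - y₂‖)
    (hdisj : closure Ω ∩ closure Λ = ∅) {P : F → F}
    (hP : ∀ x, P x ∈ closure Λ ∧ ∀ q ∈ closure Λ, dist x (P x) ≤ dist x q)
    (hproj : ∀ x, ∀ q ∈ closure Λ, ⟪x - P x, q - P x⟫ ≤ 0)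
    {z₀ : F} {r₀ : ℝ} (hr₀ : 0 < r₀) (hball : closedBall z₀ r₀ ⊆ Ω)
    {x₀ : F} (hx₀ : x₀ ∈ closure Ω) :
    ∃ δ > 0, μH[d] (P '' (touchingSet Ω P ∩ ball x₀ δ)) < ⊤ := by
  have hPmem : ∀ x, P x ∈ closure Λ := fun x => (hP x).1
  set σ : F → ℝ := fun x => ‖x - P x‖ with hσ
  set ν : F → F := fun x => (σ x)⁻¹ • (x - P x) with hν
  have hne : ∀ x ∈ closure Ω, x ≠ P x := fun x hx h => by
    have : x ∈ closure Ω ∩ closure Λ := ⟨hx, h ▸ hPmem x⟩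
    simp [hdisj] at this
  have hσ0 : ∀ x ∈ closure Ω, 0 < σ x := fun x hx => norm_pos_iff.2 (sub_ne_zero.2 (hne x hx))
  have hνN : ∀ x ∈ closure Ω, IsUnitNormal (closure Λ) (P x) (ν x) := fun x hx =>
    isUnitNormal_proj (hne x hx) (hproj x)
  have hfr : ∀ x ∈ closure Ω, P x ∈ frontier Λ := fun x hx =>
    (hνN x hx).mem_frontier hΛo (hPmem x)
  have hdec : ∀ x ∈ closure Ω, P x + σ x • ν x = x := fun x hx => by
    simp only [hν]
    rw [smul_inv_smul₀ (hσ0 x hx).ne']; abel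
  have hP1 : ∀ x₁ x₂, ‖P x₁ - P x₂‖ ≤ ‖x₁ - x₂‖ := fun x₁ x₂ =>
    norm_proj_sub_proj_le (hPmem x₁) (hPmem x₂) (hproj x₁) (hproj x₂)
  obtain ⟨r, hr, hL'⟩ := hlip _ (hfr x₀ hx₀)
  set N := ν x₀ with hN
  have hNnorm : ‖N‖ = 1 := (hνN x₀ hx₀).1
  set k := ⟪N, z₀ - x₀⟫ with hk
  set w := (z₀ - x₀) - k • N with hw
  have hNw : ⟪N, w⟫ = 0 := by
    rw [hw, inner_sub_right, real_inner_smul_right, real_inner_self_eq_norm_sq, hNnorm, ← hk]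
    ring
  have hc : 0 < r₀ / 2 := by positivity
  obtain ⟨δ, hδ, hδr, hδ₁, hδ₂⟩ := exists_pos_small (a := 1 + |k| * L) (b := r₀ / 2)
    (a' := 6 * L * (2 * ‖w‖ + r₀ / 2)) (b' := r₀ / 2 / 2) hr (by positivity) hc (by positivity)
    (by positivity)
  refine ⟨δ, hδ, ?_⟩
  set S := touchingSet Ω P ∩ ball x₀ δ with hS
  have hSδ : ∀ x ∈ S, ‖x - x₀‖ < δ := fun x hx => by simpa [dist_eq_norm] using hx.2
  have hSball : ∀ x ∈ S, P x ∈ frontier Λ ∩ ball (P x₀) r := fun x hx =>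
    ⟨hfr x hx.1.1, by
      rw [mem_ball, dist_eq_norm]
      exact ((hP1 x x₀).trans_lt (hSδ x hx)).trans_le hδr⟩
  have hνlip : ∀ x₁ ∈ S, ∀ x₂ ∈ S, ‖ν x₁ - ν x₂‖ ≤ L * ‖P x₁ - P x₂‖ :=
    fun x₁ h₁ x₂ h₂ => hL' _ (hSball x₁ h₁) _ (hSball x₂ h₂) _ _ (hνN x₁ h₁.1.1) (hνN x₂ h₂.1.1)
  have hνN₀ : ∀ x ∈ S, ‖ν x - N‖ ≤ L * δ := fun x hx =>
    (hL' _ (hSball x hx) _ ⟨hfr x₀ hx₀, mem_ball_self hr⟩ _ _ (hνN x hx.1.1)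
      (hνN x₀ hx₀)).trans (by gcongr; exact (hP1 x x₀).trans (hSδ x hx).le)
  have hσδ : ∀ x ∈ S, |σ x - σ x₀| ≤ δ := fun x hx => by
    have h₁ : ∀ a b, σ a ≤ ‖a - b‖ + σ b := fun a b => by
      have := (hP a).2 _ (hPmem b)
      rw [dist_eq_norm, dist_eq_norm] at this
      exact this.trans (norm_sub_le_norm_sub_add_norm_sub a b (P b))
    have := h₁ x x₀
    have := h₁ x₀ x
    rw [norm_sub_rev] at this
    rw [abs_le]
    constructor <;> linarith [hSδ x hx]
  choose! v hv using fun x (hx : x ∈ S) => hx.1.2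
  have hvν : ∀ x ∈ S, ⟪v x, ν x⟫ = 0 := fun x hx => by
    simp only [hν]
    rw [real_inner_smul_right, (hv x hx).2.1, mul_zero]
  have hvw : ∀ x ∈ S, r₀ / 2 ≤ ⟪v x, w⟫ := fun x hx => by
    obtain ⟨hv₁, -, hvΩ⟩ := hv x hx
    have h₁ : r₀ ≤ ⟪v x, z₀ - x⟫ := by
      have := hvΩ (z₀ - r₀ • v x) (subset_closure (hball (by
        simp [norm_smul, hv₁, abs_of_pos hr₀])))
      rw [sub_right_comm, inner_sub_right, real_inner_smul_right, real_inner_self_eq_norm_sq,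
        hv₁] at this
      linarith
    have h₂ : -δ ≤ ⟪v x, x - x₀⟫ := by
      have := abs_le.1 (abs_real_inner_le_norm (v x) (x - x₀))
      rw [hv₁, one_mul] at this
      linarith [hSδ x hx, this.1]
    have h₃ : k * ⟪v x, N⟫ ≤ |k| * (L * δ) := by
      have h₄ : |⟪v x, N⟫| ≤ L * δ := by
        have := abs_real_inner_le_norm (v x) (ν x - N)
        rw [inner_sub_right, hvν x hx, zero_sub, abs_neg, hv₁, one_mul] at this
        exact this.trans (hνN₀ x hx)
      calc k * ⟪v x, N⟫ ≤ |k * ⟪v x, N⟫| := le_abs_self _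
        _ = |k| * |⟪v x, N⟫| := abs_mul _ _
        _ ≤ _ := by gcongr
    have h₅ : ⟪v x, w⟫ = ⟪v x, z₀ - x⟫ + ⟪v x, x - x₀⟫ - k * ⟪v x, N⟫ := by
      rw [hw, inner_sub_right _ _ (k • N), real_inner_smul_right, ← inner_add_right,
        sub_add_sub_cancel]
    linarith
  rcases S.eq_empty_or_nonempty with hempty | ⟨x', hx'⟩
  · simp [hempty]
  have hw0 : w ≠ 0 := by
    intro h
    have := hvw x' hx'
    rw [h, inner_zero_right] at this
    linarith
  have hN0 : N ≠ 0 := norm_ne_zero_iff.1 (by rw [hNnorm]; exact one_ne_zero)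
  set W := (Submodule.span ℝ {N, w})ᗮ with hW
  have hWd : Module.finrank ℝ W = d := by
    have := finrank_orthogonal_span_pair hN0 hw0 hNw
    rw [← hW] at this
    omega
  set p : F → F := fun x => P x + σ x₀ • ν x with hp
  rw [← hWd]
  have : Nonempty F := ⟨x₀⟩
  refine hausdorffMeasure_image_lt_top (q := fun x => W.orthogonalProjectionOnto (p x))
    (C := 2 * (‖w‖ + r₀ / 2) / (r₀ / 2)) ?_ ?_
  · refine isBounded_iff_forall_norm_le.2 ⟨‖P x₀‖ + δ + σ x₀, ?_⟩
    rintro _ ⟨x, hx, rfl⟩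
    refine (W.norm_orthogonalProjectionOnto_apply_le _).trans ((norm_add_le _ _).trans ?_)
    rw [norm_smul, (hνN x hx.1.1).1, mul_one, Real.norm_of_nonneg (hσ0 x₀ hx₀).le]
    have := norm_le_norm_add_norm_sub (P x₀) (P x)
    linarith [hP1 x₀ x, hSδ x hx, norm_sub_rev x x₀]
  · intro x₁ h₁ x₂ h₂
    obtain ⟨hmono, hinner⟩ := parallel_displacement (hσ0 x₀ hx₀).le (hPmem x₁) (hPmem x₂)
      (hνN x₁ h₁.1.1) (hνN x₂ h₂.1.1)
    change ‖P x₁ - P x₂‖ ≤ ‖p x₁ - p x₂‖ at hmono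
    change |⟪ν x₁, p x₁ - p x₂⟫| ≤ ‖ν x₁ - ν x₂‖ * ‖p x₁ - p x₂‖ at hinner
    set Δ := p x₁ - p x₂ with hΔ
    have hνΔ : ‖ν x₁ - ν x₂‖ ≤ L * ‖Δ‖ := (hνlip x₁ h₁ x₂ h₂).trans (by gcongr)
    have hνδ : ‖ν x₁ - ν x₂‖ ≤ L * δ + L * δ := by
      have := norm_sub_le_norm_sub_add_norm_sub (ν x₁) N (ν x₂)
      rw [norm_sub_rev N] at this
      linarith [hνN₀ x₁ h₁, hνN₀ x₂ h₂]
    obtain ⟨α, l, hαl⟩ : ∃ α l : ℝ, α • N + l • w = Δ - W.starProjection Δ := by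
      rw [← Submodule.mem_span_pair]
      have := W.sub_starProjection_mem_orthogonal Δ
      have hWo : Wᗮ = Submodule.span ℝ {N, w} := Submodule.orthogonal_orthogonal _
      rwa [hWo] at this
    have hα : α = ⟪N, Δ⟫ := by
      have h₀ : ⟪N, W.starProjection Δ⟫ = 0 :=
        (Submodule.mem_orthogonal _ _).1 (W.starProjection_apply_mem Δ) N
          (Submodule.subset_span (by simp))
      have := congrArg (fun u => ⟪N, u⟫) hαl
      simp only [inner_add_right, inner_sub_right, real_inner_smul_right, h₀, hNw,
        real_inner_self_eq_norm_sq, hNnorm] at this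
      linarith
    have hexpand : ∀ x ∈ S, p x = x - (σ x - σ x₀) • ν x := fun x hx => by
      calc p x = (P x + σ x • ν x) - (σ x - σ x₀) • ν x := by simp only [hp]; module
        _ = x - (σ x - σ x₀) • ν x := by rw [hdec x hx.1.1]
    have hcone : ∀ a ∈ S, ∀ b ∈ S, ‖ν a - ν b‖ ≤ L * ‖Δ‖ →
        -(6 * L * δ * ‖Δ‖ / 2) ≤ ⟪v b, p a - p b⟫ := fun a ha b hb hab => by
      have h₀ := (hv b hb).2.2 a ha.1.1
      have h₃ : |(σ a - σ x₀) * ⟪v b, ν a⟫| ≤ δ * (L * ‖Δ‖) := by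
        have := abs_real_inner_le_norm (v b) (ν a - ν b)
        rw [inner_sub_right, hvν b hb, sub_zero, (hv b hb).1, one_mul] at this
        rw [abs_mul]
        exact mul_le_mul (hσδ a ha) (this.trans hab) (abs_nonneg _) hδ.le
      have h₄ : ⟪v b, p a - p b⟫ = ⟪v b, a - b⟫ - (σ a - σ x₀) * ⟪v b, ν a⟫ := by
        rw [hexpand a ha, hexpand b hb]
        simp only [inner_sub_right, real_inner_smul_right, hvν b hb]
        ring
      rw [h₄]
      have : 0 ≤ L * δ * ‖Δ‖ := by positivity
      linarith [(abs_le.1 h₃).2]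
    have hproj_sub : W.orthogonalProjectionOnto (p x₁) - W.orthogonalProjectionOnto (p x₂) =
        W.orthogonalProjectionOnto Δ := by rw [hΔ, map_sub]
    have hcoe : ‖W.orthogonalProjectionOnto Δ‖ = ‖W.starProjection Δ‖ := rfl
    simp only [hproj_sub, hcoe]
    refine hmono.trans (norm_le_of_notMem_cones (v₁ := v x₂) (v₂ := v x₁) (ε := 6 * L * δ)
      (α := α) (l := l) hc (by linarith) hNnorm (hv x₂ h₂).1 (hv x₁ h₁).1
      (by rw [hαl, sub_add_cancel]) ?_ (hvw x₂ h₂) (hvw x₁ h₁) (hcone x₁ h₁ x₂ h₂ hνΔ) ?_)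
    · have h₃ : |⟪ν x₁ - N, Δ⟫| ≤ L * δ * ‖Δ‖ :=
        (abs_real_inner_le_norm _ _).trans (by gcongr; exact hνN₀ x₁ h₁)
      have h₄ : |⟪ν x₁, Δ⟫| ≤ (L * δ + L * δ) * ‖Δ‖ := hinner.trans (by gcongr)
      rw [inner_sub_left] at h₃
      rw [hα, abs_le]
      have := abs_le.1 h₃
      have := abs_le.1 h₄
      constructor <;> linarith
    · have := hcone x₂ h₂ x₁ h₁ (by rwa [norm_sub_rev])
      rwa [← neg_sub, ← hΔ, inner_neg_right] at this

/-- If `Ω ⊂ ℝ^n` is a bounded convex open set and `Λ ⊂ ℝ^n` is a bounded open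
uniformly convex set with `C^{1,1}` boundary, with `cl Ω ∩ cl Λ = ∅`, and `P` denotes the metric
projection onto `cl Λ` (so `P(Ω) ⊂ ∂Λ`), then the boundary relative to `∂Λ` of the projection
set satisfies `H^{n-2}(∂(P(Ω) ∩ ∂Λ)) < ∞`. -/
theorem projection_boundary_Hn2_finite_of_disjoint
    (m : ℕ) (hm : 1 ≤ m)
    (Ω Λ : Set (EuclideanSpace ℝ (Fin (m + 1))))
    (hΩo : IsOpen Ω) (hΩb : Bornology.IsBounded Ω) (hΩconv : Convex ℝ Ω)
    (hΛo : IsOpen Λ) (hΛb : Bornology.IsBounded Λ) (hΛconv : Convex ℝ Λ)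
    (hΛuc : UniformlyConvexC11 Λ)
    (hdisj : closure Ω ∩ closure Λ = ∅)
    (P : EuclideanSpace ℝ (Fin (m + 1)) → EuclideanSpace ℝ (Fin (m + 1)))
    (hP : ∀ x, P x ∈ closure Λ ∧ ∀ q ∈ closure Λ, dist x (P x) ≤ dist x q) :
    μH[(m : ℝ) - 1] (relBd Λ (P '' Ω ∩ frontier Λ)) < ⊤ := by
  obtain ⟨L, hL, hlip⟩ := hΛuc.exists_lipschitz_normal hΛo
  have hPmem : ∀ x, P x ∈ closure Λ := fun x => (hP x).1
  have hproj : ∀ x, ∀ q ∈ closure Λ, ⟪x - P x, q - P x⟫ ≤ 0 := fun x _ hq =>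
    inner_sub_proj_le_zero hΛconv.closure (hP x).1 (hP x).2 hq
  rcases Ω.eq_empty_or_nonempty with rfl | ⟨z₀, hz₀⟩
  · simp [relBd]
  obtain ⟨r₀, hr₀, hball⟩ := nhds_basis_closedBall.mem_iff.1 (hΩo.mem_nhds hz₀)
  obtain ⟨d, rfl⟩ : ∃ d, m = d + 1 := ⟨m - 1, by omega⟩
  have hcast : ((d + 1 : ℕ) : ℝ) - 1 = d := by push_cast; ring
  rw [hcast]
  have hfin : μH[d] (P '' (touchingSet Ω P ∩ closure Ω)) < ⊤ := by
    refine hΩb.isCompact_closure.induction_on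
      (p := fun s => μH[d] (P '' (touchingSet Ω P ∩ s)) < ⊤) (by simp)
      (fun s t hst ht => (measure_mono (by gcongr)).trans_lt ht) (fun s t hs ht => ?_)
      (fun x hx => ?_)
    · rw [inter_union_distrib_left, image_union]
      exact measure_union_lt_top hs ht
    · obtain ⟨δ, hδ, hlt⟩ := exists_hausdorffMeasure_proj_touchingSet_lt_top
        (by simp : Module.finrank ℝ (EuclideanSpace ℝ (Fin (d + 1 + 1))) = d + 2) hΛo hL hlip
        hdisj hP hproj hr₀ hball hx
      exact ⟨_, mem_nhdsWithin_of_mem_nhds (ball_mem_nhds x hδ), hlt⟩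
  refine (measure_mono ((relBd_subset_image_touchingSet hΩo hΩb hΩconv hΛo hΛconv hlip hdisj hPmem
    hproj).trans (image_mono fun x hx => ?_))).trans_lt hfin
  exact ⟨hx, hx.1⟩
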